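/- Let S ⊆ ℝ² be a nice shape, X ⊆ ℝ² a finite point set, and p, q ∈ ℝ² distinct points such that no four points of X ∪ {p,q} lie on the boundary of a common S-range. Let L and R be the two open halfplanes bounded by the line through p and q. Let S₁ ∈ 𝒮_pq satisfy |X ∩ S₁| = k, suppose the interior of S₁ △ L contains a point of X, and let S₂ be the ≺-minimal element of {S' ∈ 𝒮_pq : S₁ ≺ S' and (∂S' ∖ ∂S₁) ∩ X ≠ ∅}. Then: if ∂S₁ ∩ X ∩ R ≠ ∅, then |X ∩ S₂| ∈ {k−1, k}; and if ∂S₁ ∩ X ∩ R = ∅, then |X ∩ S₂| ∈ {k, k+1}. -/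

import Mathlib

open Set

noncomputable section

/-- The Euclidean plane. -/
abbrev Pt : Type := EuclideanSpace ℝ (Fin 2)

/-- `T` is an `S`-range: a homothetic copy of `S` with positive ratio. -/
def IsRange (S T : Set Pt) : Prop :=
  ∃ (c : ℝ) (v : Pt), 0 < c ∧ T = (fun x => c • x + v) '' S

/-- A straight line in the plane. -/
def IsLine (l : Set Pt) : Prop :=
  ∃ (f : Pt →ₗ[ℝ] ℝ) (a : ℝ), f ≠ 0 ∧ l = {x | f x = a}

/-- A closed halfplane. -/
def IsClosedHalfplane (H : Set Pt) : Prop :=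
  ∃ (f : Pt →ₗ[ℝ] ℝ) (a : ℝ), f ≠ 0 ∧ H = {x | f x ≤ a}

/-- An open halfplane bounded by the line through `p` and `q`. -/
def IsOpenHalfplaneOf (p q : Pt) (L : Set Pt) : Prop :=
  ∃ (f : Pt →ₗ[ℝ] ℝ) (a : ℝ), f ≠ 0 ∧ f p = a ∧ f q = a ∧ L = {x | a < f x}

/-- `S` is a nice shape: a non-empty convex compact set such that every boundary
point has exactly one touching line and the boundary contains no non-trivial
straight line segment. -/
def NiceShape (S : Set Pt) : Prop :=
  S.Nonempty ∧ Convex ℝ S ∧ IsCompact S ∧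
  (∀ p ∈ frontier S, ∃! l : Set Pt, IsLine l ∧ l ∩ S = {p}) ∧
  (∀ x ∈ frontier S, ∀ y ∈ frontier S, segment ℝ x y ⊆ frontier S → x = y)

/-- No four points of `A` lie on the boundary of a common `S`-range. -/
def NoFourOnBoundary (S A : Set Pt) : Prop :=
  ∀ T : Set Pt, IsRange S T →
    ∀ p₁ p₂ p₃ p₄ : Pt, p₁ ∈ A ∩ frontier T → p₂ ∈ A ∩ frontier T →
      p₃ ∈ A ∩ frontier T → p₄ ∈ A ∩ frontier T →
      p₁ ≠ p₂ → p₁ ≠ p₃ → p₁ ≠ p₄ → p₂ ≠ p₃ → p₂ ≠ p₄ → p₃ ≠ p₄ → False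

/-- `X` is in general position with respect to `S`: no two points on a vertical
line, no three points collinear, and no four points on the boundary of a common
`S`-range. -/
def GenPos (S : Set Pt) (X : Finset Pt) : Prop :=
  (∀ p ∈ X, ∀ q ∈ X, p ≠ q → p 0 ≠ q 0) ∧
  (∀ p ∈ X, ∀ q ∈ X, ∀ r ∈ X, p ≠ q → p ≠ r → q ≠ r →
    ¬ Collinear ℝ ({p, q, r} : Set Pt)) ∧
  NoFourOnBoundary S ↑X

/-- The hyperedges of the `k`-uniform `S`-capturing hypergraph on `X`:
`k`-element subsets of `X` captured by some `S`-range. -/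
def capturedSets (S : Set Pt) (X : Finset Pt) (k : ℕ) : Set (Set Pt) :=
  {Y | Y ⊆ ↑X ∧ Y.ncard = k ∧ ∃ T : Set Pt, IsRange S T ∧ ↑X ∩ T = Y}

/-- The `i`-sets of `X`: `i`-element subsets of `X` separable by a straight line,
i.e. captured by a closed halfplane.  `aᵢ` is the number of such sets. -/
def iSets (X : Finset Pt) (i : ℕ) : Set (Set Pt) :=
  {Y | Y ⊆ ↑X ∧ Y.ncard = i ∧ ∃ H : Set Pt, IsClosedHalfplane H ∧ ↑X ∩ H = Y}

/-- `𝒜ᵢ`: closed halfplanes containing exactly `i` points of `X`, exactly two of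
which lie on the boundary line. -/
def repHalfplanes (X : Finset Pt) (i : ℕ) : Set (Set Pt) :=
  {H | IsClosedHalfplane H ∧ ((↑X : Set Pt) ∩ H).ncard = i ∧
    ((↑X : Set Pt) ∩ frontier H).ncard = 2}

/-- `𝒮_pq`: the `S`-ranges having both `p` and `q` on their boundary. -/
def rangesThrough (S : Set Pt) (p q : Pt) : Set (Set Pt) :=
  {T | IsRange S T ∧ p ∈ frontier T ∧ q ∈ frontier T}

/-- The ranges in `𝒮_pq` that come strictly after `S₁` (w.r.t. `≺`, i.e. inclusion
of the intersections with `L`) and have a point of `X` on their boundary that is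
not on the boundary of `S₁`. -/
def nextCandidates (S : Set Pt) (p q : Pt) (L : Set Pt) (X : Finset Pt) (S₁ : Set Pt) :
    Set (Set Pt) :=
  {S₂ | S₂ ∈ rangesThrough S p q ∧ S₁ ∩ L ⊂ S₂ ∩ L ∧
    ((frontier S₂ \ frontier S₁) ∩ ↑X).Nonempty}

/-- `ℛ₁ᵏ`: Type I ranges, i.e. `S`-ranges containing exactly `k` points of `X`,
exactly three of which are on the boundary. -/
def typeIRanges (S : Set Pt) (X : Finset Pt) (k : ℕ) : Set (Set Pt) :=
  {T | IsRange S T ∧ ((↑X : Set Pt) ∩ T).ncard = k ∧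
    ((↑X : Set Pt) ∩ frontier T).ncard = 3}

/-- `ℛ(Y)`: the Type I representative ranges of `Y`. -/
def repRanges (S : Set Pt) (X : Finset Pt) (Y : Set Pt) : Set (Set Pt) :=
  {T | IsRange S T ∧ ↑X ∩ T = Y ∧ ((↑X : Set Pt) ∩ frontier T).ncard = 3}

/-- `ℰ₁ᵏ`: Type I hyperedges. -/
def typeIEdges (S : Set Pt) (X : Finset Pt) (k : ℕ) : Set (Set Pt) :=
  {Y | Y ⊆ ↑X ∧ Y.ncard = k ∧ (repRanges S X Y).Nonempty}

/-- `ℰ₂ᵏ`: Type II hyperedges, captured by some `S`-range but by no `S`-range with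
three points of `X` on its boundary. -/
def typeIIEdges (S : Set Pt) (X : Finset Pt) (k : ℕ) : Set (Set Pt) :=
  {Y | Y ∈ capturedSets S X k ∧ ¬ (repRanges S X Y).Nonempty}

/-- The boundary condition on a nice shape makes it strictly convex. -/
theorem NiceShape.strictConvex {S : Set Pt} (hS : NiceShape S) : StrictConvex ℝ S := by
  obtain ⟨-, hconv, hcomp, -, hseg⟩ := hS
  refine hconv.strictConvex fun x hx y hy hxy => ?_
  rw [← hcomp.isClosed.frontier_eq] at hx hy
  by_contra h
  exact hxy (hseg x hx y hy (sdiff_eq_empty.1 (not_nonempty_iff_eq_empty.1 h)))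

/-- Points strictly inside a chord of a strictly convex set are interior. -/
theorem StrictConvex.add_smul_mem_interior {S : Set Pt} (hS : StrictConvex ℝ S) {A u : Pt}
    (hu : u ≠ 0) {s t : ℝ} (hA : A ∈ S) (hB : A + s • u ∈ S) (ht : 0 < t) (hts : t < s) :
    A + t • u ∈ interior S := by
  have hs : 0 < s := ht.trans hts
  have hne : A ≠ A + s • u := by
    simpa [eq_comm] using ⟨hs.ne', hu⟩
  have h := hS hA hB hne (a := 1 - t / s) (b := t / s)
    (by rw [sub_pos, div_lt_one hs]; exact hts) (by positivity) (by ring)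
  convert h using 1
  match_scalars <;> field_simp
  ring

/-- In the plane, the kernel of a nonzero functional is spanned by any of its nonzero vectors. -/
theorem exists_eq_smul_of_apply_eq_zero {f : Pt →ₗ[ℝ] ℝ} (hf : f ≠ 0) {u : Pt} (hu : u ≠ 0)
    (hfu : f u = 0) {w : Pt} (hw : f w = 0) : ∃ r : ℝ, w = r • u := by
  have h1 : Module.finrank ℝ (LinearMap.ker f) = 1 := by
    have h := f.finrank_range_add_finrank_ker
    have hr : LinearMap.range f = ⊤ := LinearMap.range_eq_top.2 (LinearMap.surjective hf)
    rw [hr, finrank_top, Module.finrank_self, finrank_euclideanSpace_fin] at h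
    omega
  have hu' : (⟨u, hfu⟩ : LinearMap.ker f) ≠ 0 := fun h => hu (congrArg Subtype.val h)
  obtain ⟨r, hr⟩ := (finrank_eq_one_iff_of_nonzero' _ hu').1 h1 ⟨w, hw⟩
  exact ⟨r, (congrArg Subtype.val hr).symm⟩

/-- The similarity of ratio `c` taking `p` to `P`. -/
def frame (p P : Pt) (c : ℝ) (y : Pt) : Pt := P + c • (y - p)

theorem continuous_frame (p P : Pt) (c : ℝ) : Continuous (frame p P c) := by
  unfold frame; fun_prop

theorem isOpenMap_frame (p P : Pt) {c : ℝ} (hc : 0 < c) : IsOpenMap (frame p P c) := by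
  have h := ((Homeomorph.addLeft P).isOpenMap.comp (isOpenMap_smul₀ (α := Pt) hc.ne')).comp
    (Homeomorph.subRight p).isOpenMap
  exact h

theorem interior_preimage_frame (S : Set Pt) (p P : Pt) {c : ℝ} (hc : 0 < c) :
    interior (frame p P c ⁻¹' S) = frame p P c ⁻¹' interior S :=
  ((isOpenMap_frame p P hc).preimage_interior_eq_interior_preimage (continuous_frame p P c) S).symm

theorem frontier_preimage_frame (S : Set Pt) (p P : Pt) {c : ℝ} (hc : 0 < c) :
    frontier (frame p P c ⁻¹' S) = frame p P c ⁻¹' frontier S :=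
  ((isOpenMap_frame p P hc).preimage_frontier_eq_frontier_preimage (continuous_frame p P c) S).symm

theorem isRange_iff {S T : Set Pt} (p : Pt) :
    IsRange S T ↔ ∃ (P : Pt) (c : ℝ), 0 < c ∧ T = frame p P c ⁻¹' S := by
  constructor
  · rintro ⟨c, v, hc, rfl⟩
    refine ⟨c⁻¹ • (p - v), c⁻¹, inv_pos.2 hc, ?_⟩
    ext y
    constructor
    · rintro ⟨x, hx, rfl⟩
      have : frame p (c⁻¹ • (p - v)) c⁻¹ (c • x + v) = x := by
        unfold frame
        match_scalars <;> field_simp <;> ring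
      simpa [mem_preimage, this] using hx
    · intro hy
      refine ⟨_, hy, ?_⟩
      simp only [frame]
      match_scalars <;> field_simp <;> ring
  · rintro ⟨P, c, hc, rfl⟩
    refine ⟨c⁻¹, p - c⁻¹ • P, inv_pos.2 hc, ?_⟩
    ext y
    constructor
    · intro hy
      refine ⟨_, hy, ?_⟩
      simp only [frame]
      match_scalars <;> field_simp <;> ring
    · rintro ⟨x, hx, rfl⟩
      have : frame p P c (c⁻¹ • x + (p - c⁻¹ • P)) = x := by
        unfold frame
        match_scalars <;> field_simp <;> ring
      simpa [mem_preimage, this] using hx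

/-- The ranges through `p` and `q` correspond to the chords of `S` in direction `q - p`. -/
theorem mem_rangesThrough_iff {S T : Set Pt} {p q : Pt} :
    T ∈ rangesThrough S p q ↔ ∃ (P : Pt) (c : ℝ), 0 < c ∧ P ∈ frontier S ∧
      P + c • (q - p) ∈ frontier S ∧ T = frame p P c ⁻¹' S := by
  constructor
  · rintro ⟨hT, hp, hq⟩
    obtain ⟨P, c, hc, rfl⟩ := (isRange_iff p).1 hT
    rw [frontier_preimage_frame S p P hc] at hp hq
    exact ⟨P, c, hc, by simpa [frame] using hp, hq, rfl⟩
  · rintro ⟨P, c, hc, hP, hQ, rfl⟩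
    refine ⟨(isRange_iff p).2 ⟨P, c, hc, rfl⟩, ?_, ?_⟩ <;> rw [frontier_preimage_frame S p P hc]
    · simpa [frame] using hP
    · exact hQ

/-- Two chords of `S` in direction `u`, the second one lower with respect to `f`: the similarity
taking the first chord to the second maps the part of `S` above the first chord into the
interior of `S`. -/
theorem map_chord_mem_interior {S : Set Pt} (hS : StrictConvex ℝ S) (hcl : IsClosed S)
    {f : Pt →ₗ[ℝ] ℝ} (hf : f ≠ 0) {u : Pt} (hu : u ≠ 0) (hfu : f u = 0)
    {P P' : Pt} {c c' : ℝ} (hc : 0 < c) (hc' : 0 < c')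
    (hP : P ∈ frontier S) (hQ : P + c • u ∈ frontier S)
    (hP' : P' ∈ S) (hQ' : P' + c' • u ∈ S) (hlt : f P' < f P)
    {w : Pt} (hw : 0 < f w) (hz : P + c • w ∈ S) : P' + c' • w ∈ interior S := by
  have hPS := hcl.frontier_subset hP
  have hQS := hcl.frontier_subset hQ
  set z := P + c • w with hzdef
  have hfz : f z = f P + c * f w := by simp [hzdef]
  have hcw : 0 < c * f w := mul_pos hc hw
  have hden : 0 < f z - f P' := by linarith
  set σ := (f P - f P') / (f z - f P') with hσ
  have hσ0 : 0 < σ := div_pos (by linarith) hden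
  have hσ1 : σ < 1 := by rw [hσ, div_lt_one hden]; linarith
  have hσm : σ * (f z - f P') = f P - f P' := div_mul_cancel₀ _ hden.ne'
  obtain ⟨ρ, hρ⟩ := exists_eq_smul_of_apply_eq_zero hf hu hfu
    (w := σ • z + (1 - σ) • P' - P) (by simp; linarith)
  have hgP : σ • z + (1 - σ) • P' = P + ρ • u := by rw [← hρ]; abel
  have hgQ : σ • z + (1 - σ) • (P' + c' • u) = P + (ρ + (1 - σ) * c') • u := by
    rw [smul_add (1 - σ), ← add_assoc, hgP]; module
  have hzP' : z ≠ P' := fun h => by rw [h] at hden; simp at hden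
  have hzQ' : z ≠ P' + c' • u := fun h => by rw [h] at hden; simp [hfu] at hden
  have hi1 := hS hz hP' hzP' hσ0 (sub_pos.2 hσ1) (by ring)
  have hi2 := hS hz hQ' hzQ' hσ0 (sub_pos.2 hσ1) (by ring)
  simp only [hgP] at hi1
  simp only [hgQ] at hi2
  have hρ0 : 0 < ρ := by
    by_contra! h
    rcases h.eq_or_lt with h | h
    · exact hP.2 (by simpa [h] using hi1)
    · refine hP.2 ?_
      have := hS.add_smul_mem_interior hu (s := c - ρ) (t := -ρ) (interior_subset hi1)
        (by convert hQS using 1; module) (by linarith) (by linarith)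
      convert this using 1; module
  have hρ1 : ρ + (1 - σ) * c' < c := by
    by_contra! h
    rcases h.eq_or_lt with h | h
    · exact hQ.2 (by rw [h]; exact hi2)
    · exact hQ.2 (hS.add_smul_mem_interior hu hPS (interior_subset hi2) hc h)
  have hd : 0 < c - (1 - σ) * c' := by linarith
  have hfoot := hS.add_smul_mem_interior hu (t := ρ * c' / (c - (1 - σ) * c')) hP' hQ'
    (by positivity) (by rw [div_lt_iff₀ hd]; nlinarith)
  have hwz : w = c⁻¹ • (z - P) := by
    rw [hzdef]; match_scalars <;> field_simp; ring
  have hPe : P = σ • z + (1 - σ) • P' - ρ • u := by rw [hgP]; abel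
  have h1σ := sub_pos.2 hσ1
  have hres := hS.convex.combo_self_interior_mem_interior hz hfoot
    (a := c' * (1 - σ) / c) (b := (c - (1 - σ) * c') / c) (by positivity) (by positivity)
    (by field_simp; ring)
  have hcoef : (c - (1 - σ) * c') / c * (ρ * c' / (c - (1 - σ) * c')) = ρ * c' / c := by
    rw [mul_comm, div_mul_div_cancel₀ hd.ne']
  rw [smul_add ((c - (1 - σ) * c') / c), smul_smul, hcoef] at hres
  convert hres using 1
  rw [hwz]
  clear_value z
  rw [hPe]
  match_scalars <;> field_simp; ring

/-- Any two distinct ranges through `p` and `q` are nested on either side of the line `pq`,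
in opposite directions. -/
theorem rangesThrough_comparable {S : Set Pt} (hS : NiceShape S) {p q : Pt} (hpq : p ≠ q)
    {f : Pt →ₗ[ℝ] ℝ} (hf : f ≠ 0) (hfpq : f q = f p) {T T' : Set Pt}
    (hT : T ∈ rangesThrough S p q) (hT' : T' ∈ rangesThrough S p q) (hne : T ≠ T') :
    (T ∩ {x | f p < f x} ⊆ interior T' ∧ T' ∩ {x | f x < f p} ⊆ interior T) ∨
    (T' ∩ {x | f p < f x} ⊆ interior T ∧ T ∩ {x | f x < f p} ⊆ interior T') := by
  have hsc := hS.strictConvex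
  have hcl : IsClosed S := hS.2.2.1.isClosed
  have hu : q - p ≠ 0 := sub_ne_zero.2 hpq.symm
  have hfu : f (q - p) = 0 := by simp [hfpq]
  have nested : ∀ {P P' : Pt} {c c' : ℝ}, 0 < c → 0 < c' → P ∈ frontier S →
      P + c • (q - p) ∈ frontier S → P' ∈ frontier S → P' + c' • (q - p) ∈ frontier S →
      f P' < f P →
      frame p P c ⁻¹' S ∩ {x | f p < f x} ⊆ interior (frame p P' c' ⁻¹' S) ∧
      frame p P' c' ⁻¹' S ∩ {x | f x < f p} ⊆ interior (frame p P c ⁻¹' S) := by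
    intro P P' c c' hc hc' hP hQ hP' hQ' hlt
    rw [interior_preimage_frame S p P hc, interior_preimage_frame S p P' hc']
    constructor
    · rintro y ⟨hy, hfy⟩
      exact map_chord_mem_interior hsc hcl hf hu hfu hc hc' hP hQ (hcl.frontier_subset hP')
        (hcl.frontier_subset hQ') hlt (by simpa using hfy) hy
    · rintro y ⟨hy, hfy⟩
      exact map_chord_mem_interior hsc hcl (neg_ne_zero.2 hf) hu (by simp [hfpq]) hc' hc hP' hQ'
        (hcl.frontier_subset hP) (hcl.frontier_subset hQ) (by simpa using hlt)
        (by simpa using hfy) hy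
  obtain ⟨P, c, hc, hP, hQ, rfl⟩ := mem_rangesThrough_iff.1 hT
  obtain ⟨P', c', hc', hP', hQ', rfl⟩ := mem_rangesThrough_iff.1 hT'
  rcases lt_trichotomy (f P) (f P') with h | h | h
  · exact Or.inr (nested hc' hc hP' hQ' hP hQ h)
  · exfalso
    obtain ⟨ρ, hρ⟩ := exists_eq_smul_of_apply_eq_zero hf hu hfu (w := P' - P) (by simp [h])
    obtain rfl : P' = P + ρ • (q - p) := by rw [← hρ]; abel
    have mS := fun {x : Pt} (hx : x ∈ frontier S) => hcl.frontier_subset hx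
    rcases lt_trichotomy ρ 0 with h0 | rfl | h0
    · refine hP.2 ?_
      have := hsc.add_smul_mem_interior hu (s := c - ρ) (t := -ρ) (mS hP')
        (by convert mS hQ using 1; module) (by linarith) (by linarith)
      convert this using 1; module
    · simp only [zero_smul, add_zero] at *
      rcases lt_trichotomy c c' with h1 | rfl | h1
      · exact hQ.2 (hsc.add_smul_mem_interior hu (mS hP) (mS hQ') hc h1)
      · exact hne rfl
      · exact hQ'.2 (hsc.add_smul_mem_interior hu (mS hP) (mS hQ) hc' h1)
    · exact hP'.2 (hsc.add_smul_mem_interior hu (s := ρ + c') (mS hP)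
        (by convert mS hQ' using 1; module) h0 (by linarith))
  · have hnested := nested hc hc' hP hQ hP' hQ' h
    exact Or.inl hnested

/-- How far one can go from `m` in direction `w` inside `S`. -/
def reach (S : Set Pt) (w m : Pt) : ℝ := sSup {t : ℝ | m + t • w ∈ S}

theorem isGreatest_reach {S : Set Pt} (hS : IsCompact S) {w : Pt} (hw : w ≠ 0) {m : Pt}
    (hm : m ∈ S) : IsGreatest {t : ℝ | m + t • w ∈ S} (reach S w m) := by
  have hcl : IsClosed {t : ℝ | m + t • w ∈ S} :=
    hS.isClosed.preimage (by fun_prop : Continuous fun t : ℝ => m + t • w)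
  have hbdd : BddAbove {t : ℝ | m + t • w ∈ S} := by
    obtain ⟨C, hC⟩ := hS.isBounded.exists_norm_le
    have hw' : 0 < ‖w‖ := norm_pos_iff.2 hw
    refine ⟨(C + ‖m‖) / ‖w‖, fun t ht => (le_div_iff₀ hw').2 ?_⟩
    have h1 : ‖t • w‖ ≤ ‖m + t • w‖ + ‖m‖ := by
      simpa using norm_sub_le (m + t • w) m
    have h2 := hC _ ht
    rw [norm_smul, Real.norm_eq_abs] at h1
    nlinarith [le_abs_self t]
  have hne : {t : ℝ | m + t • w ∈ S}.Nonempty := ⟨0, by simpa using hm⟩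
  exact ⟨hcl.csSup_mem hne hbdd, fun t ht => le_csSup hbdd ht⟩

theorem concaveOn_reach {S : Set Pt} (hS : IsCompact S) (hconv : Convex ℝ S) {w : Pt}
    (hw : w ≠ 0) : ConcaveOn ℝ S (reach S w) := by
  refine ⟨hconv, fun x hx y hy a b ha hb hab => ?_⟩
  refine (isGreatest_reach hS hw (hconv hx hy ha hb hab)).2 ?_
  have h := hconv (isGreatest_reach hS hw hx).1 (isGreatest_reach hS hw hy).1 ha hb hab
  simp only [mem_ofPred_eq, smul_eq_mul] at h ⊢
  convert h using 1
  module

theorem add_reach_smul_mem_frontier {S : Set Pt} (hS : IsCompact S) {w : Pt} (hw : w ≠ 0) {m : Pt}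
    (hm : m ∈ S) : m + reach S w m • w ∈ frontier S := by
  have hg := isGreatest_reach hS hw hm
  rw [hS.isClosed.frontier_eq]
  refine ⟨hg.1, fun hi => ?_⟩
  have hcont : Continuous fun t : ℝ => m + t • w := by fun_prop
  have hmem : (fun t : ℝ => m + t • w) ⁻¹' interior S ∈ nhds (reach S w m) :=
    (isOpen_interior.preimage hcont).mem_nhds hi
  obtain ⟨ε, hε, hball⟩ := Metric.mem_nhds_iff.1 hmem
  have h := hball (show reach S w m + ε / 2 ∈ Metric.ball (reach S w m) ε by
    rw [Metric.mem_ball, Real.dist_eq, add_sub_cancel_left, abs_of_pos (by linarith)]; linarith)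
  have := hg.2 (interior_subset (s := S) h)
  linarith

theorem reach_pos {S : Set Pt} (hS : IsCompact S) {w : Pt} (hw : w ≠ 0) {m : Pt}
    (hm : m ∈ interior S) : 0 < reach S w m := by
  have hmS := interior_subset hm
  have hg := isGreatest_reach hS hw hmS
  have h0 : 0 ≤ reach S w m := hg.2 (by simpa using hmS)
  refine h0.lt_of_ne fun h => (add_reach_smul_mem_frontier hS hw hmS).2 ?_
  simpa [← h] using hm

theorem reach_eq {S : Set Pt} (hS : IsCompact S) (hsc : StrictConvex ℝ S) {w : Pt} (hw : w ≠ 0)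
    {m : Pt} (hm : m ∈ S) {t : ℝ} (ht : 0 < t) (hmt : m + t • w ∈ frontier S) :
    reach S w m = t := by
  have hg := isGreatest_reach hS hw hm
  refine le_antisymm (not_lt.1 fun h => hmt.2 ?_) (hg.2 (hS.isClosed.frontier_subset hmt))
  exact hsc.add_smul_mem_interior hw hm hg.1 ht h

/-- A point covered by exactly one of two ranges through `p` and `q` lies on the boundary of
some range through `p` and `q`. -/
theorem exists_mem_frontier_of_mem_of_notMem {S : Set Pt} (hS : NiceShape S) {p q : Pt}
    (hpq : p ≠ q) {T T' : Set Pt} (hT : T ∈ rangesThrough S p q) (hT' : T' ∈ rangesThrough S p q)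
    {x : Pt} (hx : x ∈ T) (hx' : x ∉ T') : ∃ U ∈ rangesThrough S p q, x ∈ frontier U := by
  have hsc := hS.strictConvex
  have hcomp : IsCompact S := hS.2.2.1
  have hcl : IsClosed S := hcomp.isClosed
  set u := q - p with hudef
  have hu : u ≠ 0 := sub_ne_zero.2 hpq.symm
  have hu' : -u ≠ 0 := neg_ne_zero.2 hu
  obtain ⟨P, c, hc, hP, hQ, rfl⟩ := mem_rangesThrough_iff.1 hT
  obtain ⟨P', c', hc', hP', hQ', rfl⟩ := mem_rangesThrough_iff.1 hT'
  have mid : ∀ {A : Pt} {d : ℝ}, 0 < d → A ∈ frontier S → A + d • u ∈ frontier S →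
      A + (d / 2) • u ∈ interior S ∧ reach S u (A + (d / 2) • u) = d / 2 ∧
        reach S (-u) (A + (d / 2) • u) = d / 2 := by
    intro A d hd hA hB
    have hm : A + (d / 2) • u ∈ interior S := hsc.add_smul_mem_interior hu
      (hcl.frontier_subset hA) (hcl.frontier_subset hB) (by linarith) (by linarith)
    refine ⟨hm, reach_eq hcomp hsc hu (interior_subset hm) (by linarith) ?_,
      reach_eq hcomp hsc hu' (interior_subset hm) (by linarith) ?_⟩
    · convert hB using 1; module
    · convert hA using 1; module
  obtain ⟨hm, hr, hl⟩ := mid hc hP hQ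
  obtain ⟨hm', hr', hl'⟩ := mid hc' hP' hQ'
  set path : Pt → Pt := fun m =>
    frame p (m + reach S (-u) m • (-u)) (reach S (-u) m + reach S u m) x with hpath
  have hcont : ContinuousOn path (interior S) := by
    have h1 := (concaveOn_reach hcomp hS.2.1 hu).continuousOn_interior
    have h2 := (concaveOn_reach hcomp hS.2.1 hu').continuousOn_interior
    simp only [hpath, frame]
    fun_prop
  have hpre : IsPreconnected (path '' interior S) :=
    hS.2.1.interior.isPreconnected.image _ hcont
  have hstart : path (P + (c / 2) • u) = frame p P c x := by
    simp only [hpath, hr, hl, frame]; module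
  have hend : path (P' + (c' / 2) • u) = frame p P' c' x := by
    simp only [hpath, hr', hl', frame]; module
  obtain ⟨m, hmS, hmx⟩ : ∃ m ∈ interior S, path m ∈ frontier S := by
    by_contra! hno
    have hcover : path '' interior S ⊆ interior S ∪ Sᶜ := by
      rintro _ ⟨m, hmS, rfl⟩
      by_cases h : path m ∈ S
      · left
        by_contra hi
        exact hno m hmS (by rw [hcl.frontier_eq]; exact ⟨h, hi⟩)
      · exact Or.inr h
    obtain ⟨y, -, hy1, hy2⟩ := hpre _ _ isOpen_interior hcl.isOpen_compl hcover
      ⟨_, ⟨_, hm, hstart⟩, by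
        by_contra hi
        exact hno _ hm (by rw [hstart, hcl.frontier_eq]; exact ⟨hx, hi⟩)⟩
      ⟨_, ⟨_, hm', hend⟩, hx'⟩
    exact hy2 (interior_subset hy1)
  have hpos : 0 < reach S (-u) m + reach S u m :=
    add_pos (reach_pos hcomp hu' hmS) (reach_pos hcomp hu hmS)
  refine ⟨_, mem_rangesThrough_iff.2 ⟨m + reach S (-u) m • (-u), _, hpos,
    add_reach_smul_mem_frontier hcomp hu' (interior_subset hmS), ?_, rfl⟩, ?_⟩
  · convert add_reach_smul_mem_frontier hcomp hu (interior_subset hmS) using 1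
    module
  · rw [frontier_preimage_frame S p _ hpos]
    exact hmx

theorem isCompact_of_mem_rangesThrough {S : Set Pt} (hS : NiceShape S) {p q : Pt} {T : Set Pt}
    (hT : T ∈ rangesThrough S p q) : IsCompact T := by
  obtain ⟨c, v, -, rfl⟩ := hT.1
  exact hS.2.2.1.image (by fun_prop)

theorem strictConvex_of_mem_rangesThrough {S : Set Pt} (hS : NiceShape S) {p q : Pt} {T : Set Pt}
    (hT : T ∈ rangesThrough S p q) : StrictConvex ℝ T := by
  obtain ⟨c, v, hc, rfl⟩ := hT.1
  have h : (fun x => c • x + v) '' S = (fun x => v + x) '' ((fun x => c • x) '' S) := by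
    simp only [image_image, add_comm v]
  rw [h]
  exact hS.strictConvex.affinity v c

theorem openSegment_subset_interior_of_mem_rangesThrough {S : Set Pt} (hS : NiceShape S)
    {p q : Pt} (hpq : p ≠ q) {T : Set Pt} (hT : T ∈ rangesThrough S p q) :
    openSegment ℝ p q ⊆ interior T := by
  have hcl := (isCompact_of_mem_rangesThrough hS hT).isClosed
  exact (strictConvex_of_mem_rangesThrough hS hT).openSegment_subset
    (hcl.frontier_subset hT.2.1) (hcl.frontier_subset hT.2.2) hpq

/-- The trace of a range through `p` and `q` on the line `pq` is the segment `pq`. -/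
theorem mem_of_mem_of_apply_eq {S : Set Pt} (hS : NiceShape S) {p q : Pt} (hpq : p ≠ q)
    {f : Pt →ₗ[ℝ] ℝ} (hf : f ≠ 0) (hfpq : f q = f p) {T T' : Set Pt}
    (hT : T ∈ rangesThrough S p q) (hT' : T' ∈ rangesThrough S p q) {x : Pt}
    (hx : x ∈ T) (hfx : f x = f p) : x ∈ T' := by
  have hu : q - p ≠ 0 := sub_ne_zero.2 hpq.symm
  have hsc := strictConvex_of_mem_rangesThrough hS hT
  have hcl := (isCompact_of_mem_rangesThrough hS hT).isClosed
  have hcl' := (isCompact_of_mem_rangesThrough hS hT').isClosed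
  obtain ⟨r, hr⟩ := exists_eq_smul_of_apply_eq_zero hf hu (by simp [hfpq]) (w := x - p)
    (by simp [hfx])
  obtain rfl : x = p + r • (q - p) := by rw [← hr]; abel
  have hr0 : 0 ≤ r := by
    by_contra! h
    refine hT.2.1.2 ?_
    have := hsc.add_smul_mem_interior hu (s := 1 - r) (t := -r) hx
      (by convert hcl.frontier_subset hT.2.2 using 1; module) (by linarith) (by linarith)
    convert this using 1; module
  have hr1 : r ≤ 1 := by
    by_contra! h
    refine hT.2.2.2 ?_
    have := hsc.add_smul_mem_interior hu (hcl.frontier_subset hT.2.1) hx one_pos h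
    convert this using 1; module
  have := (strictConvex_of_mem_rangesThrough hS hT').convex (hcl'.frontier_subset hT'.2.1)
    (hcl'.frontier_subset hT'.2.2) (sub_nonneg.2 hr1) hr0 (by ring)
  convert this using 1; module

/-- Every range through `p` and `q` has boundary points on either side of the line `pq`. -/
theorem exists_mem_frontier_lt {S : Set Pt} (hS : NiceShape S) {p q : Pt} (hpq : p ≠ q)
    {f : Pt →ₗ[ℝ] ℝ} (hf : f ≠ 0) (hfpq : f q = f p) {T : Set Pt}
    (hT : T ∈ rangesThrough S p q) : ∃ y ∈ frontier T, f p < f y := by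
  have hcomp := isCompact_of_mem_rangesThrough hS hT
  have up : ∀ m ∈ interior T, ∃ y ∈ T, f m < f y := by
    intro m hm
    obtain ⟨w, hw⟩ := LinearMap.surjective hf 1
    have hw0 : w ≠ 0 := by rintro rfl; simp at hw
    refine ⟨_, (isGreatest_reach hcomp hw0 (interior_subset hm)).1, ?_⟩
    simpa [hw] using reach_pos hcomp hw0 hm
  obtain ⟨y, hyT, hy⟩ := hcomp.exists_isMaxOn ⟨p, hcomp.isClosed.frontier_subset hT.2.1⟩
    (LinearMap.continuous_of_finiteDimensional f).continuousOn
  refine ⟨y, ?_, ?_⟩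
  · rw [hcomp.isClosed.frontier_eq]
    refine ⟨hyT, fun hi => ?_⟩
    obtain ⟨z, hz, hlt⟩ := up y hi
    exact absurd (hy hz) (not_le.2 hlt)
  · have hmid := openSegment_subset_interior_of_mem_rangesThrough hS hpq hT
      ⟨1 / 2, 1 / 2, by norm_num, by norm_num, by norm_num, rfl⟩
    obtain ⟨z, hz, hlt⟩ := up _ hmid
    have h := hy hz
    simp only [mem_ofPred_eq, map_add, map_smul, hfpq, smul_eq_mul] at h hlt
    linarith

/-- An open halfplane bounded by the line `pq` other than `{x | f p < f x}` is the opposite one. -/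
theorem IsOpenHalfplaneOf.eq_opposite {p q : Pt} (hpq : p ≠ q) {f : Pt →ₗ[ℝ] ℝ} (hf : f ≠ 0)
    (hfpq : f q = f p) {R : Set Pt} (hR : IsOpenHalfplaneOf p q R)
    (hne : {x | f p < f x} ≠ R) : R = {x | f x < f p} := by
  obtain ⟨g, b, hg, rfl, hgq, rfl⟩ := hR
  have hu : q - p ≠ 0 := sub_ne_zero.2 hpq.symm
  obtain ⟨w, hw⟩ := LinearMap.surjective hf 1
  have hgf : ∀ y, g y = g w * f y := by
    intro y
    obtain ⟨r, hr⟩ := exists_eq_smul_of_apply_eq_zero hf hu (by simp [hfpq])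
      (w := y - f y • w) (by simp [hw])
    have h := congrArg g hr
    simp only [map_sub, map_smul, smul_eq_mul, hgq, sub_self, mul_zero] at h
    linarith
  rcases lt_trichotomy (g w) 0 with h | h | h
  · ext x
    simp only [mem_ofPred_eq, hgf x, hgf p, mul_lt_mul_left_of_neg h]
  · exact absurd (LinearMap.ext fun y => by simp [hgf y, h]) hg
  · refine absurd ?_ hne
    ext x
    simp only [mem_ofPred_eq, hgf x, hgf p, mul_lt_mul_iff_right₀ h]

/-- Off the line `pq`, the boundary of a range through `p` and `q` carries at most one point
of `X`. -/
theorem subsingleton_frontier_of_noFour {S : Set Pt} {X : Finset Pt} {p q : Pt} (hpq : p ≠ q)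
    (h4 : NoFourOnBoundary S (↑X ∪ {p, q})) {T : Set Pt} (hT : T ∈ rangesThrough S p q) :
    {x | x ∈ X ∧ x ∈ frontier T ∧ x ≠ p ∧ x ≠ q}.Subsingleton := by
  rintro x ⟨hxX, hxT, hxp, hxq⟩ y ⟨hyX, hyT, hyp, hyq⟩
  by_contra hxy
  exact h4 T hT.1 p q x y ⟨by simp, hT.2.1⟩ ⟨by simp, hT.2.2⟩ ⟨by simp [hxX], hxT⟩
    ⟨by simp [hyX], hyT⟩ hpq hxp.symm hyp.symm hxq.symm hyq.symm hxy

/-- if `S₁ ∈ 𝒮_pq` captures `k` points of `X` and `S₂` is the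
`≺`-minimal range after `S₁` with a new boundary point of `X`, then `S₂` contains
`k−1` or `k` points of `X` if `∂S₁ ∩ X ∩ R ≠ ∅`, and `k` or `k+1` points of `X`
if `∂S₁ ∩ X ∩ R = ∅`. -/
theorem next_range_point_count
    (S : Set Pt) (hS : NiceShape S) (X : Finset Pt)
    (p q : Pt) (hpq : p ≠ q)
    (h4 : NoFourOnBoundary S (↑X ∪ {p, q}))
    (L R : Set Pt) (hL : IsOpenHalfplaneOf p q L) (hR : IsOpenHalfplaneOf p q R)
    (hLR : L ≠ R)
    (S₁ : Set Pt) (hS₁ : S₁ ∈ rangesThrough S p q)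
    (k : ℕ) (hk : ((↑X : Set Pt) ∩ S₁).ncard = k)
    (hint : ∃ x ∈ X, x ∈ interior ((S₁ \ L) ∪ (L \ S₁)))
    (S₂ : Set Pt) (hS₂ : S₂ ∈ nextCandidates S p q L X S₁)
    (hmin : ∀ S₃ ∈ nextCandidates S p q L X S₁, ¬ (S₃ ∩ L ⊂ S₂ ∩ L)) :
    ((frontier S₁ ∩ ↑X ∩ R).Nonempty →
        ((↑X : Set Pt) ∩ S₂).ncard = k - 1 ∨ ((↑X : Set Pt) ∩ S₂).ncard = k) ∧
    (frontier S₁ ∩ ↑X ∩ R = ∅ →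
        ((↑X : Set Pt) ∩ S₂).ncard = k ∨ ((↑X : Set Pt) ∩ S₂).ncard = k + 1) := by
  obtain ⟨f, a, hf, rfl, hfpq, rfl⟩ := hL
  obtain rfl := hR.eq_opposite hpq hf hfpq hLR
  obtain ⟨hS₂r, hlt, -⟩ := hS₂
  have compare := fun {T T' : Set Pt} => rangesThrough_comparable hS hpq hf hfpq (T := T) (T' := T')
  have closed := fun {T : Set Pt} (hT : T ∈ rangesThrough S p q) =>
    (isCompact_of_mem_rangesThrough hS hT).isClosed
  have strict : ∀ {T T' : Set Pt}, T' ∈ rangesThrough S p q →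
      T ∩ {x | f p < f x} ⊆ interior T' → T ∩ {x | f p < f x} ⊂ T' ∩ {x | f p < f x} := by
    intro T T' hT' h
    refine ⟨fun x hx => ⟨interior_subset (h hx), hx.2⟩, fun h' => ?_⟩
    obtain ⟨y, hy, hfy⟩ := exists_mem_frontier_lt hS hpq hf hfpq hT'
    exact hy.2 (h (h' ⟨(closed hT').frontier_subset hy, hfy⟩))
  have hne : S₁ ≠ S₂ := by rintro rfl; exact hlt.2 subset_rfl
  obtain ⟨hLsub, hRsub⟩ : S₁ ∩ {x | f p < f x} ⊆ interior S₂ ∧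
      S₂ ∩ {x | f x < f p} ⊆ interior S₁ :=
    (compare hS₁ hS₂r hne).resolve_right fun h => (strict hS₁ h.1).2 hlt.1
  have between : ∀ T ∈ rangesThrough S p q, ∀ x ∈ X, x ∈ frontier T → x ∉ frontier S₁ →
      T ≠ S₂ → S₁ ∩ {x | f p < f x} ⊆ interior T →
      S₂ ∩ {x | f p < f x} ⊆ interior T ∧ T ∩ {x | f x < f p} ⊆ interior S₂ := by
    intro T hT x hxX hxT hx1 hT2 hsub
    refine (compare hT hS₂r hT2).resolve_left fun h => ?_
    exact hmin T ⟨hT, strict hT hsub, x, ⟨hxT, hx1⟩, hxX⟩ (strict hS₂r h.1)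
  have gained : ∀ x ∈ X, x ∈ S₂ → x ∉ S₁ → x ∈ frontier S₂ ∧ f p < f x := by
    intro x hxX hx2 hx1
    have hfx : f p < f x := by
      rcases lt_trichotomy (f x) (f p) with h | h | h
      · exact absurd (interior_subset (hRsub ⟨hx2, h⟩)) hx1
      · exact absurd (mem_of_mem_of_apply_eq hS hpq hf hfpq hS₂r hS₁ hx2 h) hx1
      · exact h
    refine ⟨?_, hfx⟩
    obtain ⟨T, hT, hxT⟩ := exists_mem_frontier_of_mem_of_notMem hS hpq hS₂r hS₁ hx2 hx1
    have hxT' := (closed hT).frontier_subset hxT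
    by_cases hT2 : T = S₂
    · exact hT2 ▸ hxT
    have hsub := ((compare hS₁ hT (by rintro rfl; exact hx1 hxT')).resolve_right
      fun h => hx1 (interior_subset (h.1 ⟨hxT', hfx⟩))).1
    exact absurd ((between T hT x hxX hxT
      (fun h => hx1 ((closed hS₁).frontier_subset h)) hT2 hsub).1 ⟨hx2, hfx⟩) hxT.2
  have lost : ∀ x ∈ X, x ∈ S₁ → x ∉ S₂ → x ∈ frontier S₁ ∧ f x < f p := by
    intro x hxX hx1 hx2
    have hfx : f x < f p := by
      rcases lt_trichotomy (f x) (f p) with h | h | h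
      · exact h
      · exact absurd (mem_of_mem_of_apply_eq hS hpq hf hfpq hS₁ hS₂r hx1 h) hx2
      · exact absurd (interior_subset (hLsub ⟨hx1, h⟩)) hx2
    refine ⟨?_, hfx⟩
    by_contra hx1f
    obtain ⟨T, hT, hxT⟩ := exists_mem_frontier_of_mem_of_notMem hS hpq hS₁ hS₂r hx1 hx2
    have hxT' := (closed hT).frontier_subset hxT
    have hsub := ((compare hS₁ hT (by rintro rfl; exact hx1f hxT)).resolve_right
      fun h => hxT.2 (h.2 ⟨hx1, hfx⟩)).1
    exact hx2 (interior_subset ((between T hT x hxX hxT hx1f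
      (by rintro rfl; exact hx2 hxT') hsub).2 ⟨hxT', hfx⟩))
  have hlost : (↑X ∩ S₁) \ (↑X ∩ S₂) = frontier S₁ ∩ ↑X ∩ {x | f x < f p} := by
    ext x
    constructor
    · rintro ⟨⟨hxX, hx1⟩, hx2⟩
      obtain ⟨h1, h2⟩ := lost x hxX hx1 fun h => hx2 ⟨hxX, h⟩
      exact ⟨⟨h1, hxX⟩, h2⟩
    · rintro ⟨⟨hx1, hxX⟩, hfx⟩
      exact ⟨⟨hxX, (closed hS₁).frontier_subset hx1⟩, fun h => hx1.2 (hRsub ⟨h.2, hfx⟩)⟩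
  have off : ∀ {x : Pt}, f x ≠ f p → x ≠ p ∧ x ≠ q := by
    intro x hx
    exact ⟨by rintro rfl; exact hx rfl, by rintro rfl; exact hx hfpq⟩
  have hgain_le : ((↑X ∩ S₂) \ (↑X ∩ S₁)).ncard ≤ 1 := by
    refine ncard_le_one_iff_subsingleton.2
      ((subsingleton_frontier_of_noFour hpq h4 hS₂r).anti ?_)
    rintro x ⟨⟨hxX, hx2⟩, hx1⟩
    obtain ⟨h1, h2⟩ := gained x hxX hx2 fun h => hx1 ⟨hxX, h⟩
    exact ⟨hxX, h1, off h2.ne'⟩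
  have hfin : ∀ T : Set Pt, (↑X ∩ T : Set Pt).Finite := fun T => X.finite_toSet.inter_of_left T
  have hcount : ((↑X : Set Pt) ∩ S₂).ncard + ((↑X ∩ S₁) \ (↑X ∩ S₂)).ncard =
      k + ((↑X ∩ S₂) \ (↑X ∩ S₁)).ncard := by
    have h1 := ncard_inter_add_ncard_sdiff_eq_ncard (↑X ∩ S₁) (↑X ∩ S₂) (hfin S₁)
    have h2 := ncard_inter_add_ncard_sdiff_eq_ncard (↑X ∩ S₂) (↑X ∩ S₁) (hfin S₂)
    rw [inter_comm] at h2
    omega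
  rw [hlost] at hcount
  constructor
  · intro hn
    have hone : (frontier S₁ ∩ ↑X ∩ {x | f x < f p}).ncard = 1 := by
      obtain ⟨x, hx⟩ := hn
      rw [ncard_eq_one]
      refine ⟨x, Subset.antisymm (fun y hy => ?_) (singleton_subset_iff.2 hx)⟩
      exact subsingleton_frontier_of_noFour hpq h4 hS₁ ⟨hy.1.2, hy.1.1, off hy.2.ne⟩
        ⟨hx.1.2, hx.1.1, off hx.2.ne⟩
    omega
  · intro he
    rw [he, ncard_empty] at hcount
    omega
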